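/- (a) If δ_n(J) = 0 for all sufficiently large n, then Φ maps Ŵ(J) into J^{(ℕ)}, giving a group homomorphism log : Ŵ(J) → J^{(ℕ)}. (b) If moreover γ is nilpotent, then log : Ŵ(J) → J^{(ℕ)} is an isomorphism of abelian groups. (This is the second part of Lemma B.20 in the case O = ℤ_p.) -/

import Mathlib

open Finset

/-- Given a map `γ` (a divided-power operation on an ideal), the operations
`δ n x = p^{(1+p+⋯+p^{n−1})−n} · γ^{∘n}(x)`, with `δ 0 = id`. -/
noncomputable def pdDelta {R : Type*} [CommRing R] (p : ℕ) (γ : R → R) (n : ℕ) (x : R) : R :=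
  (p : R) ^ ((∑ j ∈ Finset.range n, p ^ j) - n) * γ^[n] x

/-- The map `Φ : 𝕎(J) → J^ℕ`, `Φ(x)_i = Σ_{j=0}^{i} δ_{i−j}(x_j)` (informally `w_i(x)/p^i`). -/
noncomputable def pdGhost {R : Type*} [CommRing R] (p : ℕ) [Fact p.Prime] (γ : R → R)
    (x : WittVector p R) (i : ℕ) : R :=
  ∑ j ∈ Finset.range (i + 1), pdDelta p γ (i - j) (x.coeff j)

/-- For `m ≥ 1`, the ideal `J^{[m]} ⊆ R` generated by all products
`γ^{∘a_1}(x_1)⋯γ^{∘a_s}(x_s)` with the `x_i ∈ J` and `p^{a_1} + ⋯ + p^{a_s} ≥ m`.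
The divided-power structure `γ` is *nilpotent* if `J^{[m]} = 0` for some `m`. -/
noncomputable def pdIdealPow {R : Type*} [CommRing R] (p : ℕ) (J : Ideal R) (γ : R → R)
    (m : ℕ) : Ideal R :=
  Ideal.span {r | ∃ (s : ℕ) (a : Fin s → ℕ) (x : Fin s → R),
    (∀ i, x i ∈ J) ∧ m ≤ ∑ i, p ^ a i ∧ r = ∏ i, γ^[a i] (x i)}

/-- The monomial `∏ i, t i ^ (i-th base-p digit of n)`. -/
noncomputable def digitMonomial {S : Type*} [CommRing S] (p : ℕ) [Fact p.Prime] :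
    ℕ → (ℕ → S) → S
  | 0, _ => 1
  | n + 1, t => t 0 ^ ((n + 1) % p) * digitMonomial p ((n + 1) / p) (fun i => t (i + 1))
termination_by n => n
decreasing_by exact Nat.div_lt_self n.succ_pos (Fact.out : p.Prime).one_lt

section digitMonomial

variable {S : Type*} [CommRing S] (p : ℕ) [Fact p.Prime]

lemma digitMonomial_zero (t : ℕ → S) : digitMonomial p 0 t = 1 := by
  rw [digitMonomial]

lemma digitMonomial_eq (n : ℕ) (t : ℕ → S) :
    digitMonomial p n t = t 0 ^ (n % p) * digitMonomial p (n / p) (fun i => t (i + 1)) := by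
  cases n with
  | zero => simp [digitMonomial_zero]
  | succ n => rw [digitMonomial]

lemma digitMonomial_one (t : ℕ → S) : digitMonomial p 1 t = t 0 := by
  have h := (Fact.out : p.Prime).one_lt
  rw [digitMonomial_eq, Nat.mod_eq_of_lt h, Nat.div_eq_of_lt h, digitMonomial_zero]
  simp

lemma digitMonomial_pow (i : ℕ) (t : ℕ → S) : digitMonomial p (p ^ i) t = t i := by
  induction i generalizing t with
  | zero => simpa using digitMonomial_one p t
  | succ i ih =>
    have h := (Fact.out : p.Prime).pos
    rw [digitMonomial_eq, pow_succ, Nat.mul_mod_left, Nat.mul_div_cancel _ h, ih]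
    simp

/-- Digit monomials multiply up to a power of `p`, one factor for every carry. -/
lemma digitMonomial_mul (m n : ℕ) (t : ℕ → S) (ht : ∀ i, (p : S) * t (i + 1) = t i ^ p) :
    ∃ k : ℕ, digitMonomial p m t * digitMonomial p n t
      = (p : S) ^ k * digitMonomial p (m + n) t := by
  obtain ⟨N, hN⟩ : ∃ N, m + n = N := ⟨_, rfl⟩
  induction N using Nat.strong_induction_on generalizing m n t with
  | _ N ih =>
  have hp := (Fact.out : p.Prime).one_lt
  rcases Nat.eq_zero_or_pos m with rfl | hm
  · exact ⟨0, by simp [digitMonomial_zero]⟩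
  rcases Nat.eq_zero_or_pos n with rfl | hn
  · exact ⟨0, by simp [digitMonomial_zero]⟩
  have hm' := Nat.div_lt_self hm hp
  have hn' := Nat.div_lt_self hn hp
  obtain ⟨k, hk⟩ := ih (m / p + n / p) (by omega) (m / p) (n / p) (fun i => t (i + 1))
    (fun i => ht (i + 1)) rfl
  rw [digitMonomial_eq p m, digitMonomial_eq p n, digitMonomial_eq p (m + n)]
  have hmul : t 0 ^ (m % p) * digitMonomial p (m / p) (fun i => t (i + 1)) *
      (t 0 ^ (n % p) * digitMonomial p (n / p) (fun i => t (i + 1))) =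
      t 0 ^ (m % p + n % p) * ((p : S) ^ k *
        digitMonomial p (m / p + n / p) (fun i => t (i + 1))) := by
    rw [← hk]; ring
  rw [hmul]
  rcases lt_or_ge (m % p + n % p) p with hlt | hge
  · rw [Nat.add_div_eq_of_add_mod_lt hlt, Nat.add_mod, Nat.mod_eq_of_lt hlt]
    exact ⟨k, by ring⟩
  · have hcarry : 1 + (m / p + n / p) < N := by omega
    obtain ⟨l, hl⟩ := ih _ hcarry 1 (m / p + n / p) (fun i => t (i + 1))
      (fun i => ht (i + 1)) rfl
    rw [digitMonomial_one] at hl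
    have hmod : (m + n) % p = m % p + n % p - p := by
      rw [Nat.add_mod, Nat.mod_eq_sub_mod hge, Nat.mod_eq_of_lt]
      have := Nat.mod_lt m (show 0 < p by omega)
      have := Nat.mod_lt n (show 0 < p by omega)
      omega
    have hdiv : (m + n) / p = 1 + (m / p + n / p) := by
      rw [Nat.add_div (by omega), if_pos hge]; omega
    refine ⟨k + 1 + l, ?_⟩
    rw [hmod, hdiv]
    calc _ = t 0 ^ (m % p + n % p - p) * t 0 ^ p * ((p : S) ^ k *
          digitMonomial p (m / p + n / p) (fun i => t (i + 1))) := by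
            rw [← pow_add, Nat.sub_add_cancel hge]
      _ = t 0 ^ (m % p + n % p - p) * (p : S) ^ (k + 1) * (t (0 + 1) *
          digitMonomial p (m / p + n / p) (fun i => t (i + 1))) := by
            rw [← ht 0]; ring
      _ = _ := by rw [hl]; ring

lemma digitMonomial_map {S' : Type*} [CommRing S'] (f : S →+* S') (n : ℕ) (t : ℕ → S) :
    f (digitMonomial p n t) = digitMonomial p n (fun i => f (t i)) := by
  induction n using Nat.strong_induction_on generalizing t with
  | _ n ih =>
  rcases Nat.eq_zero_or_pos n with rfl | hn
  · simp [digitMonomial_zero]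
  · rw [digitMonomial_eq p n, digitMonomial_eq p n (fun i => f (t i)), map_mul, map_pow,
      ih _ (Nat.div_lt_self hn (Fact.out : p.Prime).one_lt)]

lemma digitMonomial_C_mul_X_pow {σ : Type*} (j : σ) (n q : ℕ) (c : ℕ → ℚ) (hc : ∀ i, c i ≠ 0) :
    ∃ a : ℚ, a ≠ 0 ∧
      digitMonomial p n
        (fun i => (MvPolynomial.C (c i) * MvPolynomial.X j ^ (q * p ^ i) : MvPolynomial σ ℚ))
      = MvPolynomial.C a * MvPolynomial.X j ^ (q * n) := by
  induction n using Nat.strong_induction_on generalizing q c with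
  | _ n ih =>
  rcases Nat.eq_zero_or_pos n with rfl | hn
  · exact ⟨1, one_ne_zero, by simp [digitMonomial_zero]⟩
  · obtain ⟨a, ha, h⟩ := ih (n / p) (Nat.div_lt_self hn (Fact.out : p.Prime).one_lt) (q * p)
      (fun i => c (i + 1)) (fun i => hc _)
    refine ⟨c 0 ^ (n % p) * a, mul_ne_zero (pow_ne_zero _ (hc 0)) ha, ?_⟩
    have hfun : (fun i => (MvPolynomial.C (c (i + 1)) * MvPolynomial.X j ^ (q * p ^ (i + 1)) :
        MvPolynomial σ ℚ)) =
        fun i => MvPolynomial.C (c (i + 1)) * MvPolynomial.X j ^ (q * p * p ^ i) := by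
      funext i; congr 2; ring
    rw [digitMonomial_eq, hfun, h]
    have hn : q * n = q * (n % p) + q * p * (n / p) := by
      conv_lhs => rw [← Nat.mod_add_div n p]
      ring
    rw [hn]
    simp only [map_mul, map_pow]
    ring

/-- In the product of a rational polynomial ring with `R`, the subring generated by sequences
`t j` with `p * t j (i + 1) = t j i ^ p` lifting the variables has no `p`-torsion. -/
lemma torsionFree_closure {σ R : Type*} [CommRing R] (c : ℕ → ℚ) (hc : ∀ i, c i ≠ 0)
    (t : σ → ℕ → MvPolynomial σ ℚ × R)
    (ht : ∀ j i, (p : MvPolynomial σ ℚ × R) * t j (i + 1) = t j i ^ p)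
    (hfst : ∀ j i, (t j i).1 = MvPolynomial.C (c i) * MvPolynomial.X j ^ (p ^ i))
    (x : MvPolynomial σ ℚ × R)
    (hx : x ∈ Subring.closure (Set.range fun a : σ × ℕ => t a.1 a.2))
    (hpx : (p : MvPolynomial σ ℚ × R) * x = 0) : x = 0 := by
  classical
  let b : (σ →₀ ℕ) → MvPolynomial σ ℚ × R := fun d => d.prod fun j n => digitMonomial p n (t j)
  have hb_sub : ∀ (d : σ →₀ ℕ) (s : Finset σ), d.support ⊆ s →
      b d = ∏ j ∈ s, digitMonomial p (d j) (t j) := fun d s hs =>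
    Finsupp.prod_of_support_subset d hs _ fun j _ => digitMonomial_zero p _
  have hb_mul : ∀ d e, ∃ k : ℕ, b d * b e = (p : MvPolynomial σ ℚ × R) ^ k * b (d + e) := by
    intro d e
    choose k hk using fun j => digitMonomial_mul p (d j) (e j) (t j) (ht j)
    refine ⟨∑ j ∈ d.support ∪ e.support, k j, ?_⟩
    rw [hb_sub d _ subset_union_left, hb_sub e _ subset_union_right,
      hb_sub (d + e) _ Finsupp.support_add, ← Finset.prod_pow_eq_pow_sum,
      ← Finset.prod_mul_distrib, ← Finset.prod_mul_distrib]
    exact Finset.prod_congr rfl fun j _ => hk j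
  have hb_fst : ∀ d, ∃ a : ℚ, a ≠ 0 ∧ (b d).1 = MvPolynomial.monomial d a := by
    intro d
    choose a ha h using fun j : σ => digitMonomial_C_mul_X_pow p j (d j) 1 c hc
    refine ⟨∏ j ∈ d.support, a j, Finset.prod_ne_zero_iff.2 fun j _ => ha j, ?_⟩
    rw [MvPolynomial.monomial_eq, map_prod, Finsupp.prod, ← Finset.prod_mul_distrib,
      hb_sub d _ subset_rfl, Prod.fst_prod]
    refine Finset.prod_congr rfl fun j _ => ?_
    have := digitMonomial_map p (RingHom.fst (MvPolynomial σ ℚ) R) (d j) (t j)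
    simp only [RingHom.coe_fst, hfst] at this
    rw [this]
    simpa using h j
  have hmon : ∀ y ∈ Submonoid.closure (Set.range fun a : σ × ℕ => t a.1 a.2),
      ∃ (k : ℕ) (d : σ →₀ ℕ), y = (p : MvPolynomial σ ℚ × R) ^ k * b d := by
    intro y hy
    induction hy using Submonoid.closure_induction with
    | mem y hy =>
      obtain ⟨⟨j, i⟩, rfl⟩ := hy
      refine ⟨0, Finsupp.single j (p ^ i), ?_⟩
      simp [b, Finsupp.prod_single_index, digitMonomial_zero, digitMonomial_pow]
    | one => exact ⟨0, 0, by simp [b]⟩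
    | mul y z _ _ hy hz =>
      obtain ⟨k, d, rfl⟩ := hy
      obtain ⟨l, e, rfl⟩ := hz
      obtain ⟨r, hr⟩ := hb_mul d e
      exact ⟨k + l + r, d + e, by rw [mul_mul_mul_comm, hr]; ring⟩
  have hspan : x ∈ Submodule.span ℤ (Set.range b) := by
    clear hpx
    rw [Subring.mem_closure_iff] at hx
    induction hx using AddSubgroup.closure_induction with
    | mem y hy =>
      obtain ⟨k, d, rfl⟩ := hmon y hy
      have : (p : MvPolynomial σ ℚ × R) ^ k * b d = ((p : ℤ) ^ k) • b d := by
        rw [zsmul_eq_mul]; push_cast; rfl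
      rw [this]
      exact Submodule.smul_mem _ _ (Submodule.subset_span ⟨d, rfl⟩)
    | zero => exact Submodule.zero_mem _
    | add y z _ _ hy hz => exact Submodule.add_mem _ hy hz
    | neg y _ hy => exact Submodule.neg_mem _ hy
  obtain ⟨a, rfl⟩ := (Finsupp.mem_span_range_iff_exists_finsupp).1 hspan
  choose u hu hbu using hb_fst
  have h1 : (a.sum fun d z => z • b d).1 = 0 := by
    have h := congrArg Prod.fst hpx
    have hp : (p : MvPolynomial σ ℚ) ≠ 0 := Nat.cast_ne_zero.2 (Fact.out : p.Prime).ne_zero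
    exact (mul_eq_zero.1 h).resolve_left hp
  have ha : a = 0 := by
    ext d
    have h2 := congrArg (MvPolynomial.coeff d) h1
    rw [Finsupp.sum, Prod.fst_sum, MvPolynomial.coeff_sum] at h2
    simp only [Prod.smul_fst, hbu, MvPolynomial.coeff_smul, MvPolynomial.coeff_monomial] at h2
    by_contra hd
    rw [Finset.sum_eq_single d] at h2
    · simp [hu d] at h2
      exact hd h2
    · intro e _ he
      simp [he]
    · intro he
      simp [Finsupp.notMem_support_iff.1 he]
  simp [ha]

end digitMonomial

universe u

section divided_powers

variable {R : Type u} [CommRing R] {p : ℕ} {J : Ideal R} {γ : R → R}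

lemma iterate_mem (hmaps : ∀ x ∈ J, γ x ∈ J) (n : ℕ) {x : R} (hx : x ∈ J) : γ^[n] x ∈ J := by
  induction n with
  | zero => exact hx
  | succ n ih => rw [Function.iterate_succ_apply']; exact hmaps _ ih

/-- Every ideal with a `ℤ_p`-divided-power structure is covered by a `p`-torsion-free one. -/
lemma exists_torsionFree_cover [Fact p.Prime]
    (hmaps : ∀ x ∈ J, γ x ∈ J)
    (hsmul : ∀ (a : R), ∀ x ∈ J, γ (a * x) = a ^ p * γ x)
    (hpow : ∀ x ∈ J, (p : R) * γ x = x ^ p)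
    (hadd : ∀ x ∈ J, ∀ y ∈ J, γ (x + y) = γ x + γ y +
      ∑ i ∈ Finset.Ioo 0 p, ((p.choose i / p : ℕ) : R) * x ^ i * y ^ (p - i)) :
    ∃ (A : Type u) (_ : CommRing A) (I : Ideal A) (φ : A →+* R),
      (∀ x : A, (p : A) * x = 0 → x = 0) ∧
      (∀ x ∈ J, ∃ y ∈ I, φ y = x) ∧
      ∀ x ∈ I, ∃ y ∈ I, (p : A) * y = x ^ p ∧ φ y = γ (φ x) := by
  have hp : p.Prime := Fact.out
  let c : ℕ → ℚ := fun i => Nat.rec 1 (fun _ a => a ^ p / p) i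
  have hc_succ : ∀ i, (p : ℚ) * c (i + 1) = c i ^ p := fun i =>
    mul_div_cancel₀ _ (Nat.cast_ne_zero.2 hp.ne_zero)
  have hc : ∀ i, c i ≠ 0 := by
    intro i
    induction i with
    | zero => exact one_ne_zero
    | succ i ih => exact div_ne_zero (pow_ne_zero _ ih) (Nat.cast_ne_zero.2 hp.ne_zero)
  let t : J → ℕ → MvPolynomial J ℚ × R := fun j i =>
    (MvPolynomial.C (c i) * MvPolynomial.X j ^ (p ^ i), γ^[i] j)
  have ht : ∀ j i, (p : MvPolynomial J ℚ × R) * t j (i + 1) = t j i ^ p := by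
    intro j i
    refine Prod.ext ?_ ?_
    · change (p : MvPolynomial J ℚ) * (MvPolynomial.C (c (i + 1)) * _) = (_ * _) ^ p
      rw [mul_pow, ← map_pow, ← hc_succ, map_mul, map_natCast, pow_succ, pow_mul]
      ring
    · change (p : R) * γ^[i + 1] j = (γ^[i] j) ^ p
      rw [Function.iterate_succ_apply', hpow _ (iterate_mem hmaps i j.2)]
  let A := Subring.closure (Set.range fun a : J × ℕ => t a.1 a.2)
  let T : J → ℕ → A := fun j i => ⟨t j i, Subring.subset_closure ⟨(j, i), rfl⟩⟩
  let φ : A →+* R := (RingHom.snd _ _).comp A.subtype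
  refine ⟨A, inferInstance, Ideal.span (Set.range fun a : J × ℕ => T a.1 a.2), φ, ?_, ?_, ?_⟩
  · intro x hx
    exact Subtype.ext (torsionFree_closure p c hc t ht (fun _ _ => rfl) x x.2
      (by simpa using congrArg Subtype.val hx))
  · intro x hx
    exact ⟨T ⟨x, hx⟩ 0, Ideal.subset_span ⟨(⟨x, hx⟩, 0), rfl⟩, rfl⟩
  · intro x hx
    suffices φ x ∈ J ∧ ∃ y ∈ Ideal.span (Set.range fun a : J × ℕ => T a.1 a.2),
        (p : A) * y = x ^ p ∧ φ y = γ (φ x) from this.2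
    induction hx using Submodule.span_induction with
    | mem x hx =>
      obtain ⟨⟨j, i⟩, rfl⟩ := hx
      refine ⟨iterate_mem hmaps i j.2, T j (i + 1), Ideal.subset_span ⟨(j, i + 1), rfl⟩,
        Subtype.ext (ht j i), ?_⟩
      exact Function.iterate_succ_apply' γ i (j : R)
    | zero =>
      have h0 : γ 0 = 0 := by
        simpa [zero_pow hp.ne_zero] using hsmul 0 0 J.zero_mem
      exact ⟨by simp, 0, zero_mem _, by simp [zero_pow hp.ne_zero], by simp [h0]⟩
    | add x y hx hy ihx ihy =>
      obtain ⟨hxJ, x', hx', hpx, hφx⟩ := ihx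
      obtain ⟨hyJ, y', hy', hpy, hφy⟩ := ihy
      refine ⟨by rw [map_add]; exact J.add_mem hxJ hyJ, x' + y' +
        ∑ i ∈ Finset.Ioo 0 p, ((p.choose i / p : ℕ) : A) * x ^ i * y ^ (p - i), ?_, ?_, ?_⟩
      · refine Ideal.add_mem _ (Ideal.add_mem _ hx' hy') (Ideal.sum_mem _ fun i hi => ?_)
        rw [mul_assoc]
        refine Ideal.mul_mem_left _ _ (Ideal.mul_mem_right _ _ ?_)
        exact Ideal.pow_mem_of_mem _ hx _ (Finset.mem_Ioo.1 hi).1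
      · rw [add_pow, Finset.sum_range_succ, ← Nat.Ico_zero_eq_range,
          Finset.sum_eq_sum_Ico_succ_bot hp.pos, mul_add, mul_add, hpx, hpy, Finset.mul_sum]
        have hsum : ∑ i ∈ Finset.Ioo 0 p, (p : A) * (((p.choose i / p : ℕ) : A) * x ^ i *
            y ^ (p - i)) = ∑ i ∈ Finset.Ico (0 + 1) p, x ^ i * y ^ (p - i) * (p.choose i : A) := by
          refine Finset.sum_congr (by ext i; simp [Nat.succ_le_iff]) fun i hi => ?_
          rw [Finset.mem_Ico, Nat.succ_le_iff] at hi
          conv_rhs => rw [← Nat.mul_div_cancel' (hp.dvd_choose_self hi.1.ne' hi.2)]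
          push_cast
          ring
        rw [hsum]
        simp
        ring
      · rw [map_add φ x y, hadd _ hxJ _ hyJ]
        simp [hφx, hφy]
    | smul a x _ ih =>
      obtain ⟨hxJ, x', hx', hpx, hφx⟩ := ih
      refine ⟨by rw [smul_eq_mul, map_mul]; exact J.mul_mem_left _ hxJ, a ^ p * x',
        Ideal.mul_mem_left _ _ hx', ?_, ?_⟩
      · rw [smul_eq_mul, mul_pow, ← hpx]; ring
      · rw [smul_eq_mul, map_mul, map_mul, map_pow, hφx, hsmul _ _ hxJ]

lemma le_sum_pow [Fact p.Prime] (n : ℕ) : n ≤ ∑ j ∈ Finset.range n, p ^ j := by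
  calc n = ∑ _j ∈ Finset.range n, 1 := by simp
    _ ≤ _ := Finset.sum_le_sum fun j _ => Nat.one_le_pow _ _ (Fact.out : p.Prime).pos

lemma exists_lift_iterate {A : Type*} [CommRing A] {I : Ideal A} {φ : A →+* R}
    (h : ∀ x ∈ I, ∃ y ∈ I, (p : A) * y = x ^ p ∧ φ y = γ (φ x)) (n : ℕ) {x : A} (hx : x ∈ I) :
    ∃ y ∈ I, (p : A) ^ (∑ j ∈ Finset.range n, p ^ j) * y = x ^ p ^ n ∧ φ y = γ^[n] (φ x) := by
  induction n with
  | zero => exact ⟨x, hx, by simp, rfl⟩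
  | succ n ih =>
    obtain ⟨y, hy, hpy, hφy⟩ := ih
    obtain ⟨z, hz, hpz, hφz⟩ := h y hy
    refine ⟨z, hz, ?_, by rw [hφz, hφy, Function.iterate_succ_apply']⟩
    rw [Finset.sum_range_succ', pow_zero, pow_succ, mul_assoc, hpz, pow_succ p n, pow_mul, ← hpy,
      mul_pow, ← pow_mul, Finset.sum_mul]
    simp only [pow_succ]

lemma exists_lift_pdDelta [Fact p.Prime] {A : Type*} [CommRing A] {I : Ideal A} {φ : A →+* R}
    (h : ∀ x ∈ I, ∃ y ∈ I, (p : A) * y = x ^ p ∧ φ y = γ (φ x)) (n : ℕ) {x : A} (hx : x ∈ I) :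
    ∃ y, (p : A) ^ n * y = x ^ p ^ n ∧ φ y = pdDelta p γ n (φ x) := by
  obtain ⟨y, -, hpy, hφy⟩ := exists_lift_iterate h n hx
  refine ⟨(p : A) ^ ((∑ j ∈ Finset.range n, p ^ j) - n) * y, ?_, ?_⟩
  · rw [← mul_assoc, ← pow_add, Nat.add_sub_cancel' (le_sum_pow n), hpy]
  · simp [pdDelta, hφy]

lemma exists_lift_pdGhost [Fact p.Prime] {A : Type*} [CommRing A] {I : Ideal A} {φ : A →+* R}
    (h : ∀ x ∈ I, ∃ y ∈ I, (p : A) * y = x ^ p ∧ φ y = γ (φ x)) (n : ℕ) {x : WittVector p A}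
    (hx : ∀ i, x.coeff i ∈ I) :
    ∃ y, (p : A) ^ n * y = WittVector.ghostComponent n x ∧
      φ y = pdGhost p γ (WittVector.map φ x) n := by
  choose y hy hφy using fun j => exists_lift_pdDelta h (n - j) (hx j)
  refine ⟨∑ j ∈ Finset.range (n + 1), y j, ?_, ?_⟩
  · rw [WittVector.ghostComponent_apply, aeval_wittPolynomial, Finset.mul_sum]
    refine Finset.sum_congr rfl fun j hj => ?_
    rw [← hy, ← mul_assoc, ← pow_add, Nat.add_sub_cancel' (by simpa [Nat.lt_succ_iff] using hj)]
  · simp [pdGhost, hφy, WittVector.map_coeff]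

lemma wittVector_add_coeff_mem [Fact p.Prime] {A : Type*} [CommRing A] {I : Ideal A} {x y : WittVector p A}
    (hx : ∀ i, x.coeff i ∈ I) (hy : ∀ i, y.coeff i ∈ I) (i : ℕ) : (x + y).coeff i ∈ I := by
  have hker : ∀ z : WittVector p A,
      (∀ i, z.coeff i ∈ I) ↔ WittVector.map (Ideal.Quotient.mk I) z = 0 := fun z => by
    simp [WittVector.ext_iff, WittVector.map_coeff, Ideal.Quotient.eq_zero_iff_mem]
  exact (hker _).2 (by rw [map_add, (hker x).1 hx, (hker y).1 hy, add_zero]) i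

lemma pdGhost_add [Fact p.Prime]
    (hmaps : ∀ x ∈ J, γ x ∈ J)
    (hsmul : ∀ (a : R), ∀ x ∈ J, γ (a * x) = a ^ p * γ x)
    (hpow : ∀ x ∈ J, (p : R) * γ x = x ^ p)
    (hadd : ∀ x ∈ J, ∀ y ∈ J, γ (x + y) = γ x + γ y +
      ∑ i ∈ Finset.Ioo 0 p, ((p.choose i / p : ℕ) : R) * x ^ i * y ^ (p - i))
    {x y : WittVector p R} (hx : ∀ i, x.coeff i ∈ J) (hy : ∀ i, y.coeff i ∈ J) (n : ℕ) :
    pdGhost p γ (x + y) n = pdGhost p γ x n + pdGhost p γ y n := by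
  obtain ⟨A, _, I, φ, htf, hlift, hγ⟩ := exists_torsionFree_cover hmaps hsmul hpow hadd
  choose u huI hu using fun i => hlift _ (hx i)
  choose v hvI hv using fun i => hlift _ (hy i)
  have hux : WittVector.map φ (WittVector.mk p u) = x := by
    ext i; simp [WittVector.map_coeff, hu]
  have hvy : WittVector.map φ (WittVector.mk p v) = y := by
    ext i; simp [WittVector.map_coeff, hv]
  have hU : ∀ i, (WittVector.mk p u).coeff i ∈ I := huI
  have hV : ∀ i, (WittVector.mk p v).coeff i ∈ I := hvI
  obtain ⟨a, ha, hφa⟩ := exists_lift_pdGhost hγ n hU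
  obtain ⟨b, hb, hφb⟩ := exists_lift_pdGhost hγ n hV
  obtain ⟨c, hc, hφc⟩ := exists_lift_pdGhost hγ n (wittVector_add_coeff_mem hU hV)
  have htf_pow : ∀ (k : ℕ) (z : A), (p : A) ^ k * z = 0 → z = 0 := by
    intro k
    induction k with
    | zero => simp
    | succ k ih => exact fun z hz => htf _ (ih _ (by rw [← mul_assoc, ← pow_succ, hz]))
  have hcab : c = a + b := sub_eq_zero.1 <| htf_pow n _ <| by
    rw [mul_sub, mul_add, ha, hb, hc, map_add, sub_self]
  rw [map_add, hux, hvy] at hφc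
  rw [← hφc, hcab, map_add, hφa, hφb, hux, hvy]

lemma pdDelta_mem {K : Ideal R} (n : ℕ) {x : R} (h : γ^[n] x ∈ K) : pdDelta p γ n x ∈ K :=
  K.mul_mem_left _ h

lemma pdDelta_apply_zero [Fact p.Prime]
    (hsmul : ∀ (a : R), ∀ x ∈ J, γ (a * x) = a ^ p * γ x) (n : ℕ) : pdDelta p γ n 0 = 0 := by
  have h0 : γ 0 = 0 := by
    simpa [zero_pow (Fact.out : p.Prime).ne_zero] using hsmul 0 0 J.zero_mem
  rw [pdDelta, Function.iterate_fixed h0, mul_zero]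

lemma pdGhost_eq [Fact p.Prime] (x : WittVector p R) (i : ℕ) :
    pdGhost p γ x i = ∑ j ∈ Finset.range i, pdDelta p γ (i - j) (x.coeff j) + x.coeff i := by
  simp [pdGhost, Finset.sum_range_succ, pdDelta]

lemma pdIdealPow_anti {m n : ℕ} (h : m ≤ n) : pdIdealPow p J γ n ≤ pdIdealPow p J γ m :=
  Ideal.span_mono fun _ ⟨s, a, x, hx, hn, hr⟩ => ⟨s, a, x, hx, h.trans hn, hr⟩

lemma le_pdIdealPow_one : J ≤ pdIdealPow p J γ 1 := fun x hx =>
  Ideal.subset_span ⟨1, fun _ => 0, fun _ => x, fun _ => hx, by simp, by simp⟩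

lemma pdIdealPow_le (hmaps : ∀ x ∈ J, γ x ∈ J) {m : ℕ} (hm : 1 ≤ m) :
    pdIdealPow p J γ m ≤ J := by
  refine Ideal.span_le.2 ?_
  rintro _ ⟨s, a, x, hx, hs, rfl⟩
  cases s with
  | zero => simp at hs; omega
  | succ s =>
    rw [Fin.prod_univ_succ]
    exact J.mul_mem_right _ (iterate_mem hmaps _ (hx 0))

lemma pdIdealPow_mul_le (m n : ℕ) :
    pdIdealPow p J γ m * pdIdealPow p J γ n ≤ pdIdealPow p J γ (m + n) := by
  rw [pdIdealPow, pdIdealPow, Ideal.span_mul_span', Ideal.span_le]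
  rintro _ ⟨_, ⟨s, a, x, hx, hs, rfl⟩, _, ⟨s', a', x', hx', hs', rfl⟩, rfl⟩
  refine Ideal.subset_span ⟨s + s', Fin.append a a', Fin.append x x', ?_, ?_, ?_⟩
  · intro i
    refine Fin.addCases (fun i => ?_) (fun i => ?_) i
    · simpa using hx i
    · simpa using hx' i
  · simpa [Fin.sum_univ_add] using add_le_add hs hs'
  · simp [Fin.prod_univ_add]

lemma pow_mem_pdIdealPow {m : ℕ} {x : R} (hx : x ∈ pdIdealPow p J γ m) (k : ℕ) :
    x ^ k ∈ pdIdealPow p J γ (k * m) := by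
  induction k with
  | zero =>
    refine Ideal.subset_span ⟨0, Fin.elim0, Fin.elim0, fun i => i.elim0, by simp, by simp⟩
  | succ k ih =>
    rw [pow_succ, Nat.succ_mul]
    exact pdIdealPow_mul_le _ _ (Ideal.mul_mem_mul ih hx)

lemma map_mem_pdIdealPow [Fact p.Prime]
    (hmaps : ∀ x ∈ J, γ x ∈ J)
    (hsmul : ∀ (a : R), ∀ x ∈ J, γ (a * x) = a ^ p * γ x)
    (hadd : ∀ x ∈ J, ∀ y ∈ J, γ (x + y) = γ x + γ y +
      ∑ i ∈ Finset.Ioo 0 p, ((p.choose i / p : ℕ) : R) * x ^ i * y ^ (p - i))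
    {m : ℕ} (hm : 1 ≤ m) {x : R} (hx : x ∈ pdIdealPow p J γ m) :
    γ x ∈ pdIdealPow p J γ (p * m) := by
  have hp : p.Prime := Fact.out
  have hJ := pdIdealPow_le (p := p) hmaps hm
  rw [pdIdealPow] at hx
  induction hx using Submodule.span_induction with
  | mem x hx =>
    obtain ⟨s, a, x, hx, hs, rfl⟩ := hx
    cases s with
    | zero => simp at hs; omega
    | succ s =>
      rw [Fin.prod_univ_succ, mul_comm (γ^[a 0] (x 0)), hsmul _ _ (iterate_mem hmaps _ (hx 0)),
        ← Function.iterate_succ_apply' γ]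
      have hle : p * m ≤ p * (∑ i : Fin s, p ^ a i.succ) + p ^ (a 0 + 1) := by
        rw [Fin.sum_univ_succ] at hs
        calc p * m ≤ p * (p ^ a 0 + ∑ i : Fin s, p ^ a i.succ) := Nat.mul_le_mul_left _ hs
          _ = _ := by ring
      refine pdIdealPow_anti hle (pdIdealPow_mul_le _ _ (Ideal.mul_mem_mul ?_ ?_))
      · exact pow_mem_pdIdealPow (Ideal.subset_span
          ⟨s, fun i => a i.succ, fun i => x i.succ, fun i => hx _, le_rfl, rfl⟩) p
      · exact Ideal.subset_span ⟨1, fun _ => a 0 + 1, fun _ => x 0, fun _ => hx 0,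
          by simp, by simp⟩
  | zero =>
    have h0 : γ 0 = 0 := by
      simpa [zero_pow hp.ne_zero] using hsmul 0 0 J.zero_mem
    rw [h0]
    exact zero_mem _
  | add x y hx hy ihx ihy =>
    rw [hadd x (hJ hx) y (hJ hy)]
    refine Ideal.add_mem _ (Ideal.add_mem _ ihx ihy) (Ideal.sum_mem _ fun i hi => ?_)
    rw [Finset.mem_Ioo] at hi
    rw [mul_assoc]
    refine Ideal.mul_mem_left _ _ ?_
    have := pdIdealPow_mul_le _ _ (Ideal.mul_mem_mul (pow_mem_pdIdealPow hx i)
      (pow_mem_pdIdealPow hy (p - i)))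
    rwa [← add_mul, Nat.add_sub_cancel' hi.2.le] at this
  | smul a x hx ih =>
    rw [smul_eq_mul, hsmul _ _ (hJ hx)]
    exact Ideal.mul_mem_left _ _ ih

lemma iterate_mem_pdIdealPow [Fact p.Prime]
    (hmaps : ∀ x ∈ J, γ x ∈ J)
    (hsmul : ∀ (a : R), ∀ x ∈ J, γ (a * x) = a ^ p * γ x)
    (hadd : ∀ x ∈ J, ∀ y ∈ J, γ (x + y) = γ x + γ y +
      ∑ i ∈ Finset.Ioo 0 p, ((p.choose i / p : ℕ) : R) * x ^ i * y ^ (p - i))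
    {m : ℕ} (hm : 1 ≤ m) (n : ℕ) {x : R} (hx : x ∈ pdIdealPow p J γ m) :
    γ^[n] x ∈ pdIdealPow p J γ (p ^ n * m) := by
  induction n with
  | zero => simpa using hx
  | succ n ih =>
    rw [Function.iterate_succ_apply', pow_succ', mul_assoc]
    exact map_mem_pdIdealPow hmaps hsmul hadd
      (Nat.mul_pos (pow_pos (Fact.out : p.Prime).pos n) hm) ih

/-- The unique sequence with `g i = Σ_{j ≤ i} δ_{i-j}(x_j)`. -/
noncomputable def pdGhostInv (p : ℕ) (γ : R → R) (g : ℕ → R) (i : ℕ) : R :=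
  g i - ∑ j : Fin i, pdDelta p γ (i - j) (pdGhostInv p γ g j)

lemma pdGhostInv_eq (g : ℕ → R) (i : ℕ) : pdGhostInv p γ g i =
    g i - ∑ j ∈ Finset.range i, pdDelta p γ (i - j) (pdGhostInv p γ g j) := by
  rw [pdGhostInv, Finset.sum_range fun j => pdDelta p γ (i - j) (pdGhostInv p γ g j)]

lemma pdGhostInv_mem (hmaps : ∀ x ∈ J, γ x ∈ J) {g : ℕ → R} (hg : ∀ i, g i ∈ J) (i : ℕ) :
    pdGhostInv p γ g i ∈ J := by
  induction i using Nat.strong_induction_on with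
  | _ i ih =>
  rw [pdGhostInv_eq]
  exact J.sub_mem (hg i) (J.sum_mem fun j hj =>
    pdDelta_mem _ (iterate_mem hmaps _ (ih j (Finset.mem_range.1 hj))))

lemma pdGhostInv_eventually_mem [Fact p.Prime]
    (hmaps : ∀ x ∈ J, γ x ∈ J)
    (hsmul : ∀ (a : R), ∀ x ∈ J, γ (a * x) = a ^ p * γ x)
    (hadd : ∀ x ∈ J, ∀ y ∈ J, γ (x + y) = γ x + γ y +
      ∑ i ∈ Finset.Ioo 0 p, ((p.choose i / p : ℕ) : R) * x ^ i * y ^ (p - i))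
    {n₀ : ℕ} (hdelta : ∀ n, n₀ ≤ n → ∀ x ∈ J, pdDelta p γ n x = 0)
    {g : ℕ → R} (hg : ∀ i, g i ∈ J) {N : ℕ} (hgN : ∀ i, N ≤ i → g i = 0) (s : ℕ) :
    ∃ M, ∀ i, M ≤ i → pdGhostInv p γ g i ∈ pdIdealPow p J γ (p ^ s) := by
  have hp : p.Prime := Fact.out
  induction s with
  | zero => exact ⟨0, fun i _ => by simpa using le_pdIdealPow_one (pdGhostInv_mem hmaps hg i)⟩
  | succ s ih =>
    obtain ⟨M, hM⟩ := ih
    refine ⟨M + n₀ + N, fun i hi => ?_⟩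
    rw [pdGhostInv_eq, hgN i (by omega), zero_sub]
    refine neg_mem (Ideal.sum_mem _ fun j hj => ?_)
    rw [Finset.mem_range] at hj
    rcases le_or_gt n₀ (i - j) with hn | hn
    · rw [hdelta _ hn _ (pdGhostInv_mem hmaps hg j)]
      exact zero_mem _
    · have h := iterate_mem_pdIdealPow hmaps hsmul hadd (Nat.one_le_pow s p hp.pos) (i - j)
        (hM j (by omega))
      refine pdDelta_mem _ (pdIdealPow_anti ?_ h)
      rw [← pow_add]
      exact Nat.pow_le_pow_right hp.pos (by omega)

end divided_powers

/-- **Lemma B.20, second part, case `O = ℤ_p`.**  Let `J` be an ideal of a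
commutative ring `R` equipped with a `ℤ_p`-divided-power structure `γ`.
(a) If `δ n (J) = 0` for all sufficiently large `n`, then `Φ` maps `Ŵ(J)` (Witt vectors with
finitely many nonzero coefficients, all in `J`) into `J^{(ℕ)}` (finitely supported sequences
with values in `J`), giving a group homomorphism `log : Ŵ(J) → J^{(ℕ)}`.
(b) If moreover `γ` is nilpotent, then `log : Ŵ(J) → J^{(ℕ)}` is an isomorphism of abelian
groups (injective and surjective onto `J^{(ℕ)}`). -/
theorem wittVector_pd_log {R : Type*} [CommRing R] (p : ℕ) [Fact p.Prime]
    (J : Ideal R) (γ : R → R)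
    (hmaps : ∀ x ∈ J, γ x ∈ J)
    (hsmul : ∀ (a : R), ∀ x ∈ J, γ (a * x) = a ^ p * γ x)
    (hpow : ∀ x ∈ J, (p : R) * γ x = x ^ p)
    (hadd : ∀ x ∈ J, ∀ y ∈ J, γ (x + y) = γ x + γ y +
      ∑ i ∈ Finset.Ioo 0 p, ((p.choose i / p : ℕ) : R) * x ^ i * y ^ (p - i))
    (hdelta : ∃ N, ∀ n, N ≤ n → ∀ x ∈ J, pdDelta p γ n x = 0) :
    -- (a): `Φ` maps `Ŵ(J)` into `J^{(ℕ)}` ...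
    (∀ x : WittVector p R, (∀ i, x.coeff i ∈ J) → (∃ N, ∀ i, N ≤ i → x.coeff i = 0) →
      (∀ i, pdGhost p γ x i ∈ J) ∧ (∃ M, ∀ i, M ≤ i → pdGhost p γ x i = 0)) ∧
    -- ... giving a group homomorphism `log`
    (∀ x y : WittVector p R,
      (∀ i, x.coeff i ∈ J) → (∃ N, ∀ i, N ≤ i → x.coeff i = 0) →
      (∀ i, y.coeff i ∈ J) → (∃ N, ∀ i, N ≤ i → y.coeff i = 0) →
      ∀ i, pdGhost p γ (x + y) i = pdGhost p γ x i + pdGhost p γ y i) ∧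
    -- (b): if `γ` is nilpotent then `log` is an isomorphism of abelian groups
    ((∃ m, 1 ≤ m ∧ pdIdealPow p J γ m = ⊥) →
      (∀ x y : WittVector p R,
        (∀ i, x.coeff i ∈ J) → (∃ N, ∀ i, N ≤ i → x.coeff i = 0) →
        (∀ i, y.coeff i ∈ J) → (∃ N, ∀ i, N ≤ i → y.coeff i = 0) →
        (∀ i, pdGhost p γ x i = pdGhost p γ y i) → x = y) ∧
      (∀ g : ℕ → R, (∀ i, g i ∈ J) → (∃ N, ∀ i, N ≤ i → g i = 0) →
        ∃ x : WittVector p R, (∀ i, x.coeff i ∈ J) ∧ (∃ N, ∀ i, N ≤ i → x.coeff i = 0) ∧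
          ∀ i, pdGhost p γ x i = g i)) := by
  obtain ⟨n₀, hn₀⟩ := hdelta
  refine ⟨fun x hx ⟨N, hN⟩ => ⟨fun i => J.sum_mem fun j _ =>
      pdDelta_mem _ (iterate_mem hmaps _ (hx j)), N + n₀, fun i hi => ?_⟩,
    fun x y hx _ hy _ i => pdGhost_add hmaps hsmul hpow hadd hx hy i, ?_⟩
  · refine Finset.sum_eq_zero fun j _ => ?_
    rcases le_or_gt N j with hj | hj
    · rw [hN j hj, pdDelta_apply_zero hsmul]
    · exact hn₀ _ (by omega) _ (hx j)
  rintro ⟨m, -, hm⟩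
  refine ⟨fun x y _ _ _ _ hxy => ?_, fun g hg ⟨N, hN⟩ => ?_⟩
  · ext i
    induction i using Nat.strong_induction_on with
    | _ i ih =>
    have h := hxy i
    rw [pdGhost_eq, pdGhost_eq, Finset.sum_congr rfl fun j hj => by
      rw [ih j (Finset.mem_range.1 hj)]] at h
    exact add_left_cancel h
  · obtain ⟨M, hM⟩ := pdGhostInv_eventually_mem hmaps hsmul hadd hn₀ hg hN m
    refine ⟨WittVector.mk p (pdGhostInv p γ g), pdGhostInv_mem hmaps hg, ⟨M, fun i hi => ?_⟩,
      fun i => ?_⟩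
    · have h := pdIdealPow_anti (Nat.lt_pow_self (Fact.out : p.Prime).one_lt).le (hM i hi)
      rw [hm] at h
      exact h
    · rw [pdGhost_eq, WittVector.coeff_mk, pdGhostInv_eq g i]
      exact add_sub_cancel _ _
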